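/- Let λ ∈ (0, 1/π), ν > −1/2, and suppose σ(λ) < 1 + 2ν. Write σ = σ(λ) and s = s(λ). Then −(3σ²/2)·ln 2 + [J₊(ν,λ) − J₋(ν,λ)] − 2·[J₊(0,λ) − J₋(0,λ)] = C_S(ν,s), where C_S(ν,s) := −(3σ²/2)·ln 2 − σ²/2 + 6ζ'(−1) + (1/6)·ln 2 + 2[F(ν−s) + F(ν+s) − 2F(−s) − 2F(s)] + 4[F(−1/2) − F(ν−1/2)] + ln π − 2·ln Γ(1/2+ν) + ln[Γ(s)²·Γ(1−s+ν)/(Γ(1−s)²·Γ(1+s+ν))] − 2ν·ln[Γ(1−s+ν)·Γ(1+s+ν)/Γ(1/2+ν)²] + (1+2ν)·ln(s+ν). -/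

import Mathlib

/- STATEMENT 6: the exact constant term in Proposition 3.2 (small-t expansion
of the action integral), from Proposition 3.1 at ν and at 0. -/

/-- `σ(λ) = (2/π)·arcsin(πλ)`. -/
noncomputable def sig (l : ℝ) : ℝ := 2 / Real.pi * Real.arcsin (Real.pi * l)

/-- `s(λ) = (1 − σ(λ))/2`. -/
noncomputable def sfun (l : ℝ) : ℝ := (1 - sig l) / 2

/-- `J₊(ν,λ) = ∫₀^λ σ(λ')·(d/dλ')[ln Γ(ν + (1+σ(λ'))/2)] dλ'`. -/
noncomputable def Jp (ν l : ℝ) : ℝ :=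
  ∫ l' in (0:ℝ)..l, sig l' * deriv (fun x => Real.log (Real.Gamma (ν + (1 + sig x) / 2))) l'

/-- `J₋(ν,λ) = ∫₀^λ σ(λ')·(d/dλ')[ln Γ(ν + (1−σ(λ'))/2)] dλ'`. -/
noncomputable def Jm (ν l : ℝ) : ℝ :=
  ∫ l' in (0:ℝ)..l, sig l' * deriv (fun x => Real.log (Real.Gamma (ν + (1 - sig x) / 2))) l'

/-- `FG z = ln G(1+z)`, `G` the Barnes G-function, via the integral representation. -/
noncomputable def FG (z : ℝ) : ℝ :=
  z / 2 * Real.log (2 * Real.pi) - z * (z + 1) / 2 + z * Real.log (Real.Gamma (1 + z))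
    - ∫ x in (0:ℝ)..z, Real.log (Real.Gamma (1 + x))

/-- `ζ'(−1)`, the derivative of the Riemann zeta function at `−1` (a real number). -/
noncomputable def zetaD1 : ℝ := (deriv riemannZeta (-1)).re

/-- The constant `C_S(ν,s)` (with `σ = 1 − 2s`). -/
noncomputable def CS (ν s : ℝ) : ℝ :=
  -(3 * (1 - 2*s)^2 / 2) * Real.log 2 - (1 - 2*s)^2 / 2 + 6 * zetaD1 + (1/6) * Real.log 2
    + 2 * (FG (ν - s) + FG (ν + s) - 2 * FG (-s) - 2 * FG s)
    + 4 * (FG (-(1/2)) - FG (ν - 1/2))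
    + Real.log Real.pi - 2 * Real.log (Real.Gamma (1/2 + ν))
    + Real.log (Real.Gamma s ^ 2 * Real.Gamma (1 - s + ν)
        / (Real.Gamma (1 - s) ^ 2 * Real.Gamma (1 + s + ν)))
    - 2 * ν * Real.log (Real.Gamma (1 - s + ν) * Real.Gamma (1 + s + ν)
        / Real.Gamma (1/2 + ν) ^ 2)
    + (1 + 2*ν) * Real.log (s + ν)

section partA
open Real Set MeasureTheory intervalIntegral

theorem aux_analytic_Gamma {x : ℝ} (hx : 0 < x) : AnalyticAt ℝ Real.Gamma x := by
  have h : AnalyticAt ℂ Complex.Gamma (x : ℂ) := by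
    have hopen : IsOpen {z : ℂ | 0 < z.re} := isOpen_lt continuous_const Complex.continuous_re
    have hd : DifferentiableOn ℂ Complex.Gamma {z : ℂ | 0 < z.re} := by
      intro z hz
      apply DifferentiableAt.differentiableWithinAt
      apply Complex.differentiableAt_Gamma
      intro m hm
      simp only [mem_ofPred_eq, hm, Complex.neg_re, Complex.natCast_re] at hz
      have : (0:ℝ) ≤ m := Nat.cast_nonneg m
      linarith
    exact hd.analyticAt (hopen.mem_nhds (by simpa using hx))
  have h2 := h.re_ofReal
  refine h2.congr ?_
  filter_upwards with y
  simp [Complex.Gamma_ofReal]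

theorem aux_analytic_LG {x : ℝ} (hx : 0 < x) :
    AnalyticAt ℝ (fun x => Real.log (Real.Gamma x)) x := by
  exact (aux_analytic_Gamma hx).log (Real.Gamma_pos_of_pos hx)

theorem aux_cont_LG : ContinuousOn (fun x => Real.log (Real.Gamma x)) (Ioi 0) :=
  fun _ hx => (aux_analytic_LG hx).continuousAt.continuousWithinAt

theorem aux_int_LG {a b : ℝ} (ha : 0 < a) (hb : 0 < b) :
    IntervalIntegrable (fun x => Real.log (Real.Gamma x)) volume a b := by
  apply ContinuousOn.intervalIntegrable
  apply aux_cont_LG.mono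
  intro x hx
  have := (lt_min ha hb).trans_le hx.1
  exact this

noncomputable def auxM (y : ℝ) : ℝ := ∫ x in (1:ℝ)..y, Real.log (Real.Gamma x)

theorem auxM_sub {a b : ℝ} (ha : 0 < a) (hb : 0 < b) :
    auxM b - auxM a = ∫ x in a..b, Real.log (Real.Gamma x) := by
  unfold auxM
  rw [intervalIntegral.integral_interval_sub_left (aux_int_LG one_pos hb) (aux_int_LG one_pos ha)]

theorem auxM_deriv {y : ℝ} (hy : 0 < y) : HasDerivAt auxM (Real.log (Real.Gamma y)) y := by
  apply intervalIntegral.integral_hasDerivAt_right (aux_int_LG one_pos hy)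
  · exact aux_cont_LG.stronglyMeasurableAtFilter isOpen_Ioi y hy
  · exact (aux_analytic_LG hy).continuousAt

theorem aux_LG_succ {y : ℝ} (hy : 0 < y) :
    Real.log (Real.Gamma (y + 1)) = Real.log y + Real.log (Real.Gamma y) := by
  rw [Real.Gamma_add_one hy.ne', Real.log_mul hy.ne' (Real.Gamma_pos_of_pos hy).ne']

theorem aux_raabe0 : ∃ C : ℝ, ∀ y : ℝ, 0 < y →
    auxM (y + 1) - auxM y = y * Real.log y - y + C := by
  refine ⟨auxM 2 - auxM 1 + 1, fun y hy => ?_⟩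
  have hd : ∀ x ∈ Ioi (0:ℝ), HasDerivAt
      (fun x => auxM (x + 1) - auxM x - (x * Real.log x - x)) 0 x := by
    intro x hx
    have hx' : (0:ℝ) < x := hx
    have h1 : HasDerivAt (fun x => auxM (x + 1)) (Real.log (Real.Gamma (x + 1))) x := by
      simpa using (auxM_deriv (by linarith : (0:ℝ) < x + 1)).comp_add_const x 1
    have h2 := ((hasDerivAt_id x).mul (Real.hasDerivAt_log hx'.ne')).sub (hasDerivAt_id x)
    have h3 := (h1.sub (auxM_deriv hx')).sub h2
    refine h3.congr_deriv ?_
    rw [aux_LG_succ hx']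
    simp only [id]
    field_simp
    ring
  have := (convex_Ioi (0:ℝ)).is_const_of_fderivWithin_eq_zero (𝕜 := ℝ)
    (f := fun x => auxM (x + 1) - auxM x - (x * Real.log x - x))
    (fun x hx => (hd x hx).differentiableAt.differentiableWithinAt)
    (fun x hx => by
      have h := (hd x hx).hasFDerivAt.hasFDerivWithinAt (s := Ioi 0)
      rw [h.fderivWithin (isOpen_Ioi.uniqueDiffWithinAt hx)]
      ext; simp) (x := y) (y := 1) hy (by simp)
  norm_num at this
  linarith

theorem aux_dup {x : ℝ} (hx : 0 < x) : Real.log (Real.Gamma x) + Real.log (Real.Gamma (x + 1/2))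
    = Real.log (Real.Gamma (2 * x)) + (1 - 2 * x) * Real.log 2 + 1/2 * Real.log π := by
  have h := Real.Gamma_mul_Gamma_add_half_of_pos hx
  have h1 := (Real.Gamma_pos_of_pos hx).ne'
  have h2 := (Real.Gamma_pos_of_pos (by linarith : 0 < x + 1/2)).ne'
  have h3 := (Real.Gamma_pos_of_pos (by linarith : 0 < 2 * x)).ne'
  have h4 : (2:ℝ) ^ (1 - 2 * x) ≠ 0 := (Real.rpow_pos_of_pos two_pos _).ne'
  have h5 : √π ≠ 0 := (Real.sqrt_pos.2 Real.pi_pos).ne'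
  rw [← Real.log_mul h1 h2, h, Real.log_mul (mul_ne_zero h3 h4) h5, Real.log_mul h3 h4,
    Real.log_rpow two_pos, Real.log_sqrt Real.pi_pos.le]
  ring

theorem aux_raabe {y : ℝ} (hy : 0 < y) :
    auxM (y + 1) = auxM y + (y * Real.log y - y + 1/2 * Real.log (2 * π)) := by
  obtain ⟨C, hC⟩ := aux_raabe0
  have h1 := hC (1/2) (by norm_num)
  have h2 := hC 1 (by norm_num)
  have h3 := auxM_sub (a := 1/2) (b := 1) (by norm_num) (by norm_num)
  have h4 := auxM_sub (a := 1) (b := 3/2) (by norm_num) (by norm_num)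
  have h5 := auxM_sub (a := 1) (b := 2) (by norm_num) (by norm_num)
  have h6 : ∫ x in (1/2:ℝ)..1, Real.log (Real.Gamma (x + 1/2))
      = ∫ x in (1:ℝ)..(3/2), Real.log (Real.Gamma x) := by
    rw [intervalIntegral.integral_comp_add_right (fun x => Real.log (Real.Gamma x))]
    norm_num
  have h7 : ∫ x in (1/2:ℝ)..1, Real.log (Real.Gamma (2 * x))
      = 1/2 * ∫ x in (1:ℝ)..2, Real.log (Real.Gamma x) := by
    rw [intervalIntegral.integral_comp_mul_left (fun x => Real.log (Real.Gamma x)) two_ne_zero]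
    norm_num
  have i1 : IntervalIntegrable (fun x => Real.log (Real.Gamma (x + 1/2))) volume (1/2) 1 := by
    have := (aux_int_LG (a := 1) (b := 3/2) (by norm_num) (by norm_num)).comp_add_right (1/2)
    norm_num at this
    simpa using this
  have i2 : IntervalIntegrable (fun x => Real.log (Real.Gamma (2 * x))) volume (1/2) 1 := by
    have := (aux_int_LG (a := 1) (b := 2) (by norm_num) (by norm_num)).comp_mul_left (c := 2)
    norm_num at this
    simpa using this
  have h8 : (∫ x in (1/2:ℝ)..1, Real.log (Real.Gamma x)) +
      ∫ x in (1/2:ℝ)..1, Real.log (Real.Gamma (x + 1/2)) =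
      (∫ x in (1/2:ℝ)..1, Real.log (Real.Gamma (2 * x))) +
        ∫ x in (1/2:ℝ)..1, ((1 - 2 * x) * Real.log 2 + 1/2 * Real.log π) := by
    rw [← intervalIntegral.integral_add (aux_int_LG (by norm_num) (by norm_num)) i1,
      ← intervalIntegral.integral_add i2 (by apply Continuous.intervalIntegrable; fun_prop)]
    apply intervalIntegral.integral_congr
    intro x hx
    rw [uIcc_of_le (by norm_num)] at hx
    have := aux_dup (x := x) (by linarith [hx.1])
    simp only
    linarith
  have h9 : ∫ x in (1/2:ℝ)..1, ((1 - 2 * x) * Real.log 2 + 1/2 * Real.log π)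
      = -(1/4) * Real.log 2 + 1/4 * Real.log π := by
    rw [intervalIntegral.integral_add (by apply Continuous.intervalIntegrable; fun_prop)
      (by simp), intervalIntegral.integral_mul_const, intervalIntegral.integral_sub (by simp)
      (by apply Continuous.intervalIntegrable; fun_prop), intervalIntegral.integral_const_mul]
    simp
    ring
  have h10 := hC y hy
  have hl : Real.log (1/2) = - Real.log 2 := by simp
  rw [hl] at h1
  rw [Real.log_mul two_ne_zero Real.pi_ne_zero]
  rw [h6, h7, h9, ← h3, ← h4, ← h5] at h8
  norm_num at h1 h2 h8
  linarith

theorem aux_sig_analytic {l : ℝ} (h0 : 0 ≤ l) (h1 : l < 1 / π) : AnalyticAt ℝ sig l := by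
  have h2 : π * l < 1 := by
    rw [lt_div_iff₀ Real.pi_pos] at h1; linarith
  have h3 : 0 ≤ π * l := mul_nonneg Real.pi_pos.le h0
  have h4 : ContDiffAt ℝ ⊤ Real.arcsin (π * l) :=
    Real.contDiffAt_arcsin (by linarith) (by linarith)
  unfold sig
  exact analyticAt_const.mul (h4.analyticAt.fun_comp (analyticAt_const.mul analyticAt_id))

theorem aux_sig_zero : sig 0 = 0 := by simp [sig]

theorem aux_sig_mono {a b : ℝ} (h : a ≤ b) : sig a ≤ sig b := by
  unfold sig
  apply mul_le_mul_of_nonneg_left _ (by positivity)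
  exact Real.monotone_arcsin (mul_le_mul_of_nonneg_left h Real.pi_pos.le)

theorem aux_sig_lt_one {l : ℝ} (h1 : l < 1 / π) : sig l < 1 := by
  have h2 : π * l < 1 := by
    rw [lt_div_iff₀ Real.pi_pos] at h1; linarith
  have h3 : Real.arcsin (π * l) < π / 2 := Real.arcsin_lt_pi_div_two.2 h2
  unfold sig
  rw [div_mul_eq_mul_div, div_lt_one Real.pi_pos]
  linarith

theorem aux_sig_pos {l : ℝ} (h1 : 0 < l) : 0 < sig l := by
  unfold sig
  have := Real.arcsin_pos.2 (mul_pos Real.pi_pos h1)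
  positivity

theorem aux_J {lam ν e : ℝ} (he : e ≠ 0) (h0 : 0 < lam) (h1 : lam < 1 / π)
    (hpos : ∀ l ∈ Icc 0 lam, 0 < ν + (1 + e * sig l) / 2) :
    ∫ l' in (0:ℝ)..lam, sig l' *
      deriv (fun x => Real.log (Real.Gamma (ν + (1 + e * sig x) / 2))) l'
    = sig lam * Real.log (Real.Gamma (ν + (1 + e * sig lam) / 2))
      + 2 * e⁻¹ * (auxM (ν + 1/2) - auxM (ν + (1 + e * sig lam) / 2)) := by
  have hin : ∀ l ∈ Icc 0 lam, AnalyticAt ℝ (fun x => ν + (1 + e * sig x) / 2) l := by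
    intro l hl
    have := aux_sig_analytic hl.1 (hl.2.trans_lt h1)
    fun_prop
  have han : ∀ l ∈ Icc 0 lam,
      AnalyticAt ℝ (fun x => Real.log (Real.Gamma (ν + (1 + e * sig x) / 2))) l := by
    intro l hl
    exact AnalyticAt.comp_of_eq (g := fun x => Real.log (Real.Gamma x))
      (f := fun x => ν + (1 + e * sig x) / 2) (aux_analytic_LG (hpos l hl)) (hin l hl) rfl
  rw [intervalIntegral.integral_eq_sub_of_hasDerivAt
    (f := fun l => sig l * Real.log (Real.Gamma (ν + (1 + e * sig l) / 2))
      - 2 * e⁻¹ * auxM (ν + (1 + e * sig l) / 2))]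
  · simp only [aux_sig_zero]
    simp only [mul_zero, add_zero, zero_mul]
    ring
  · intro l hl
    rw [uIcc_of_le h0.le] at hl
    have hs := (aux_sig_analytic hl.1 (hl.2.trans_lt h1)).differentiableAt.hasDerivAt
    have ha := (han l hl).differentiableAt.hasDerivAt
    have hi : HasDerivAt (fun x => ν + (1 + e * sig x) / 2) (e * deriv sig l / 2) l :=
      (((hs.const_mul e).const_add 1).div_const 2).const_add ν
    have hM := (auxM_deriv (hpos l hl)).comp l hi
    have := (hs.mul ha).sub (hM.const_mul (2 * e⁻¹))
    refine this.congr_deriv ?_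
    field_simp
    ring
  · apply ContinuousOn.intervalIntegrable
    intro l hl
    rw [uIcc_of_le h0.le] at hl
    apply ContinuousAt.continuousWithinAt
    exact (aux_sig_analytic hl.1 (hl.2.trans_lt h1)).continuousAt.mul (han l hl).deriv.continuousAt

theorem aux_FG (z : ℝ) : FG z = z / 2 * Real.log (2 * π) - z * (z + 1) / 2
    + z * Real.log (Real.Gamma (1 + z)) - auxM (1 + z) := by
  unfold FG auxM
  rw [intervalIntegral.integral_comp_add_left (fun x => Real.log (Real.Gamma x))]
  simp
end partA
section partB
open Complex Set Filter Topology

theorem aux_diff_bound {f f' : ℝ → ℂ} {a M : ℝ} (h : ∀ x, a ≤ x → HasDerivAt f (f' x) x)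
    (hb : ∀ x, a ≤ x → ‖f' x‖ ≤ M) : ∀ x, a ≤ x → ‖f (x + 1) - f x‖ ≤ M := by
  intro x hx
  have := (convex_Ici a).norm_image_sub_le_of_norm_hasDerivWithin_le
    (f := f) (f' := f') (C := M) (fun y hy => (h y hy).hasDerivWithinAt) (fun y hy => hb y hy)
    (x := x) (y := x + 1) hx (mem_Ici.2 (by linarith))
  simpa using this

theorem aux_diff_deriv {f f' : ℝ → ℂ} {a : ℝ} (h : ∀ x, a ≤ x → HasDerivAt f (f' x) x) :
    ∀ x, a ≤ x → HasDerivAt (fun x => f (x + 1) - f x) (f' (x + 1) - f' x) x := by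
  intro x hx
  exact ((h (x + 1) (by linarith)).comp_add_const x 1).sub (h x hx)

theorem aux_cpow_deriv (c r : ℂ) {x : ℝ} (hx : 0 < x) :
    HasDerivAt (fun y : ℝ => c * (y : ℂ) ^ r) ((c * r) * (x : ℂ) ^ (r - 1)) x := by
  have h1 : HasDerivAt (fun z : ℂ => c * z ^ r) (c * (r * (x : ℂ) ^ (r - 1) * 1)) (x : ℂ) :=
    ((hasDerivAt_id (x : ℂ)).cpow_const (Or.inl (by simpa using hx))).const_mul c
  have := h1.comp_ofReal
  refine this.congr_deriv (by ring)

theorem aux_third_diff (r : ℂ) {k M : ℝ} (hk : 0 < k)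
    (hM : ∀ x : ℝ, k ≤ x → ‖r * (r - 1) * (r - 2) * (x : ℂ) ^ (r - 3)‖ ≤ M) :
    ‖((k + 3 : ℝ) : ℂ) ^ r - 3 * ((k + 2 : ℝ) : ℂ) ^ r + 3 * ((k + 1 : ℝ) : ℂ) ^ r
      - ((k : ℝ) : ℂ) ^ r‖ ≤ M := by
  have d0 : ∀ x, k ≤ x → HasDerivAt (fun y : ℝ => 1 * (y : ℂ) ^ r) _ x :=
    fun x hx => aux_cpow_deriv 1 r (hk.trans_le hx)
  have d1 : ∀ x, k ≤ x → HasDerivAt (fun y : ℝ => (1 * r) * (y : ℂ) ^ (r - 1)) _ x :=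
    fun x hx => aux_cpow_deriv _ _ (hk.trans_le hx)
  have d2 : ∀ x, k ≤ x → HasDerivAt (fun y : ℝ => (1 * r * (r - 1)) * (y : ℂ) ^ (r - 1 - 1)) _ x :=
    fun x hx => aux_cpow_deriv _ _ (hk.trans_le hx)
  have b2 := aux_diff_bound d2 (M := M) (by
    intro x hx
    convert hM x hx using 3
    · ring
    · congr 1; ring)
  have b1 := aux_diff_bound (aux_diff_deriv d1) b2
  have b0 := aux_diff_bound (aux_diff_deriv (aux_diff_deriv d0)) b1 k le_rfl
  convert b0 using 2
  have e2 : k + 1 + 1 = k + 2 := by ring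
  have e1 : k + 2 + 1 = k + 3 := by ring
  simp only [e2, e1]
  ring

noncomputable def auxE (k : ℕ) (s : ℂ) : ℂ := (-1) ^ k * (k : ℂ) ^ (-s)

noncomputable def auxT (k : ℕ) (s : ℂ) : ℂ :=
  -(auxE (k + 1) s + 3 * auxE (k + 2) s + 3 * auxE (k + 3) s + auxE (k + 4) s)

def auxU : Set ℂ := {s : ℂ | -(3/2) < s.re} ∩ Metric.ball 0 10

theorem auxU_open : IsOpen auxU :=
  (isOpen_lt continuous_const Complex.continuous_re).inter Metric.isOpen_ball

theorem auxU_preconnected : IsPreconnected auxU :=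
  ((convex_halfSpace_re_gt _).inter (convex_ball 0 10)).isPreconnected

theorem auxT_bound (k : ℕ) {s : ℂ} (hs : s ∈ auxU) :
    ‖auxT k s‖ ≤ 1320 * ((k + 1 : ℕ) : ℝ) ^ (-(3/2) : ℝ) := by
  obtain ⟨h1, h2⟩ := hs
  simp only [mem_ofPred_eq] at h1
  rw [mem_ball_zero_iff] at h2
  have hk : (1:ℝ) ≤ ((k + 1 : ℕ) : ℝ) := by exact_mod_cast Nat.succ_le_succ (Nat.zero_le k)
  have := aux_third_diff (-s) (k := ((k + 1 : ℕ) : ℝ))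
    (M := 1320 * ((k + 1 : ℕ) : ℝ) ^ (-(3/2) : ℝ)) (by linarith) (by
    intro x hx
    have hx1 : 1 ≤ x := hk.trans hx
    rw [norm_mul, norm_cpow_eq_rpow_re_of_pos (by linarith)]
    have hn : ‖-s * (-s - 1) * (-s - 2)‖ ≤ 1320 := by
      rw [norm_mul, norm_mul]
      have n1 : ‖-s‖ ≤ 10 := by rw [norm_neg]; exact h2.le
      have n2 : ‖-s - 1‖ ≤ 11 := (norm_sub_le _ _).trans (by simp at n1 ⊢; linarith)
      have n3 : ‖-s - 2‖ ≤ 12 := (norm_sub_le _ _).trans (by simp at n1 ⊢; linarith)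
      calc _ ≤ (10:ℝ) * 11 * 12 := by gcongr
        _ = _ := by norm_num
    have hp : x ^ (-s - 3).re ≤ ((k + 1 : ℕ) : ℝ) ^ (-(3/2) : ℝ) := by
      calc x ^ (-s - 3).re ≤ x ^ (-(3/2) : ℝ) := by
            apply Real.rpow_le_rpow_of_exponent_le hx1
            simp; linarith
        _ ≤ _ := Real.rpow_le_rpow_of_nonpos (by linarith) hx (by norm_num)
    gcongr)
  refine le_trans (le_of_eq ?_) this
  have hsign : auxT k s = (-1) ^ (k+1) * (((((k + 1 : ℕ) : ℝ) + 3 : ℝ) : ℂ) ^ (-s)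
      - 3 * ((((k + 1 : ℕ) : ℝ) + 2 : ℝ) : ℂ) ^ (-s)
      + 3 * ((((k + 1 : ℕ) : ℝ) + 1 : ℝ) : ℂ) ^ (-s) - ((((k + 1 : ℕ) : ℝ) : ℝ) : ℂ) ^ (-s)) := by
    unfold auxT auxE
    push_cast
    have e1 : (k : ℂ) + 1 + 3 = k + 4 := by ring
    have e2 : (k : ℂ) + 1 + 2 = k + 3 := by ring
    have e3 : (k : ℂ) + 1 + 1 = k + 2 := by ring
    rw [e1, e2, e3]
    ring
  rw [hsign, norm_mul]
  simp

theorem auxE_diff {k : ℕ} (hk : k ≠ 0) (s : ℂ) :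
    HasDerivAt (auxE k) ((-1) ^ k * (-((k : ℂ) ^ (-s) * Complex.log k))) s := by
  unfold auxE
  have h := ((hasDerivAt_id s).neg.const_cpow (c := (k : ℂ)) (Or.inl (by exact_mod_cast hk)))
  refine (h.const_mul ((-1 : ℂ) ^ k)).congr_deriv ?_
  simp

theorem auxT_diff (k : ℕ) (s : ℂ) : HasDerivAt (auxT k)
    (-((-1) ^ (k+1) * (-(((k+1 : ℕ) : ℂ) ^ (-s) * Complex.log (k+1 : ℕ)))
    + 3 * ((-1) ^ (k+2) * (-(((k+2 : ℕ) : ℂ) ^ (-s) * Complex.log (k+2 : ℕ))))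
    + 3 * ((-1) ^ (k+3) * (-(((k+3 : ℕ) : ℂ) ^ (-s) * Complex.log (k+3 : ℕ))))
    + (-1) ^ (k+4) * (-(((k+4 : ℕ) : ℂ) ^ (-s) * Complex.log (k+4 : ℕ))))) s := by
  unfold auxT
  exact ((((auxE_diff (by simp) s).add ((auxE_diff (by simp) s).const_mul 3)).add
    ((auxE_diff (by simp) s).const_mul 3)).add (auxE_diff (by simp) s)).neg

theorem auxT_summable : Summable (fun k : ℕ => 1320 * ((k + 1 : ℕ) : ℝ) ^ (-(3/2) : ℝ)) := by
  apply Summable.mul_left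
  exact (summable_nat_add_iff 1).2 (Real.summable_nat_rpow.2 (by norm_num))

noncomputable def auxCZ (s : ℂ) : ℂ := HurwitzZeta.cosZeta ((1/2 : ℝ) : UnitAddCircle) s

theorem aux_half_ne : ((1/2 : ℝ) : UnitAddCircle) ≠ 0 := by
  intro h
  rw [AddCircle.coe_eq_zero_iff] at h
  obtain ⟨n, hn⟩ := h
  simp at hn
  have h2 : (2 * n : ℝ) = 1 := by rw [hn]; norm_num
  have h3 : 2 * n = 1 := by exact_mod_cast h2
  omega

theorem auxCZ_diff : Differentiable ℂ auxCZ :=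
  HurwitzZeta.differentiable_cosZeta_of_ne_zero aux_half_ne

theorem auxCZ_hasSum {s : ℂ} (hs : 1 < s.re) : HasSum (fun k => auxE k s) (auxCZ s) := by
  have h := HurwitzZeta.hasSum_nat_cosZeta (1/2) hs
  convert! h using 2 with n
  unfold auxE
  have : Real.cos (2 * Real.pi * (1/2) * n) = (-1) ^ n := by
    rw [show 2 * Real.pi * (1/2) * n = n * Real.pi by ring, Real.cos_nat_mul_pi]
  rw [this, Complex.cpow_neg]
  push_cast
  rw [div_eq_mul_inv]

theorem auxCZ_eq1 {s : ℂ} (hs : 1 < s.re) : auxCZ s = (2 ^ (1 - s) - 1) * riemannZeta s := by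
  have hz : HasSum (fun n : ℕ => 1 / (n : ℂ) ^ s) (riemannZeta s) := by
    rw [zeta_eq_tsum_one_div_nat_cpow hs]
    exact (Complex.summable_one_div_nat_cpow.2 hs).hasSum
  have h1 := (auxCZ_hasSum hs).add hz
  have he : HasSum (fun k : ℕ => auxE (2 * k) s + 1 / ((2 * k : ℕ) : ℂ) ^ s)
      (2 ^ (1 - s) * riemannZeta s) := by
    convert! hz.mul_left (2 ^ (1 - s)) using 2 with k
    unfold auxE
    rw [Complex.cpow_sub _ _ two_ne_zero, Complex.cpow_neg]
    push_cast
    have : ((2 : ℂ) * k) ^ s = 2 ^ s * (k : ℂ) ^ s := by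
      have := Complex.natCast_mul_natCast_cpow 2 k s
      exact_mod_cast this
    rw [this, cpow_one]
    simp
    ring
  have ho : HasSum (fun k : ℕ => auxE (2 * k + 1) s + 1 / ((2 * k + 1 : ℕ) : ℂ) ^ s) 0 := by
    convert! hasSum_zero using 2 with k
    unfold auxE
    rw [Complex.cpow_neg]
    simp [pow_succ]
  have h2 := he.even_add_odd (f := fun k : ℕ => auxE k s + 1 / (k : ℂ) ^ s) ho
  have h3 := h1.unique h2
  linear_combination h3

theorem auxCZ_eq {s : ℂ} (hs : s ≠ 1) : auxCZ s = (2 ^ (1 - s) - 1) * riemannZeta s := by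
  have ha : AnalyticOnNhd ℂ auxCZ {1}ᶜ :=
    auxCZ_diff.differentiableOn.analyticOnNhd isOpen_compl_singleton
  have hb : AnalyticOnNhd ℂ (fun s => (2 ^ (1 - s) - 1) * riemannZeta s) {1}ᶜ := by
    apply DifferentiableOn.analyticOnNhd _ isOpen_compl_singleton
    intro z hz
    apply DifferentiableAt.differentiableWithinAt
    apply DifferentiableAt.mul _ (differentiableAt_riemannZeta hz)
    apply DifferentiableAt.sub _ (by fun_prop)
    apply DifferentiableAt.const_cpow (by fun_prop) (Or.inl two_ne_zero)
  refine ha.eqOn_of_preconnected_of_eventuallyEq hb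
    (isConnected_compl_singleton_of_one_lt_rank (by simp) 1).isPreconnected
    (z₀ := 2) (by simp) ?_ hs
  have : {z : ℂ | 1 < z.re} ∈ 𝓝 (2 : ℂ) :=
    (isOpen_lt continuous_const Complex.continuous_re).mem_nhds (by simp)
  filter_upwards [this] with z hz
  exact auxCZ_eq1 hz

theorem aux_zeta_neg_one : riemannZeta (-1) = -1/12 := by
  have := riemannZeta_neg_nat_eq_bernoulli' 1
  norm_num at this
  rw [this]
  norm_num

theorem auxCZ_deriv : deriv auxCZ (-1) = 1/3 * Complex.log 2 + 3 * deriv riemannZeta (-1) := by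
  have heq : auxCZ =ᶠ[𝓝 (-1)] (fun s => (2 ^ (1 - s) - 1) * riemannZeta s) := by
    filter_upwards [isOpen_compl_singleton.mem_nhds (by norm_num : (-1 : ℂ) ∈ ({1}ᶜ : Set ℂ))]
      with z hz
    exact auxCZ_eq hz
  rw [heq.deriv_eq]
  have h1 : HasDerivAt (fun s : ℂ => (2 : ℂ) ^ (1 - s) - 1)
      ((2 : ℂ) ^ (1 - (-1 : ℂ)) * Complex.log 2 * (-1)) (-1) :=
    (((hasDerivAt_id (-1 : ℂ)).const_sub 1).const_cpow (Or.inl two_ne_zero)).sub_const 1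
  have h2 := (differentiableAt_riemannZeta (s := -1) (by norm_num)).hasDerivAt
  have h3 := h1.mul h2
  have h4 : (2 : ℂ) ^ (1 - (-1 : ℂ)) = 4 := by
    rw [show (1 - (-1) : ℂ) = ((2 : ℕ) : ℂ) by norm_num, Complex.cpow_natCast]; norm_num
  have h5 : deriv (fun s : ℂ => ((2 : ℂ) ^ (1 - s) - 1) * riemannZeta s) (-1) = _ := h3.deriv
  rw [h5, h4, aux_zeta_neg_one]
  ring

theorem auxT_tsum1 {s : ℂ} (hs : 1 < s.re) : ∑' k, auxT k s =
    -8 * auxCZ s + 7 * auxE 1 s + 4 * auxE 2 s + auxE 3 s := by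
  have h := auxCZ_hasSum hs
  have e0 : auxE 0 s = 0 := by
    have : s ≠ 0 := by rintro rfl; simp at hs; linarith
    simp [auxE, this]
  have s1 := (hasSum_nat_add_iff' 1).2 h
  have s2 := (hasSum_nat_add_iff' 2).2 h
  have s3 := (hasSum_nat_add_iff' 3).2 h
  have s4 := (hasSum_nat_add_iff' 4).2 h
  have := (((s1.add (s2.mul_left 3)).add (s3.mul_left 3)).add s4).neg
  have h6 : ∑' k, auxT k s = _ := this.tsum_eq
  rw [h6]
  simp only [Finset.sum_range_succ, Finset.sum_range_zero, e0]
  ring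

theorem auxT_tsum {s : ℂ} (hs : s ∈ auxU) : ∑' k, auxT k s =
    -8 * auxCZ s + 7 * auxE 1 s + 4 * auxE 2 s + auxE 3 s := by
  have ha : AnalyticOnNhd ℂ (fun s => ∑' k, auxT k s) auxU :=
    (differentiableOn_tsum_of_summable_norm auxT_summable
      (fun i z _ => (auxT_diff i z).differentiableAt.differentiableWithinAt) auxU_open
      (fun i w hw => auxT_bound i hw)).analyticOnNhd auxU_open
  have hb : AnalyticOnNhd ℂ (fun s => -8 * auxCZ s + 7 * auxE 1 s + 4 * auxE 2 s + auxE 3 s)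
      auxU := by
    apply DifferentiableOn.analyticOnNhd _ auxU_open
    intro z hz
    have d0 := auxCZ_diff z
    have d1 := (auxE_diff one_ne_zero z).differentiableAt
    have d2 := (auxE_diff two_ne_zero z).differentiableAt
    have d3 := (auxE_diff three_ne_zero z).differentiableAt
    apply DifferentiableAt.differentiableWithinAt
    fun_prop
  refine ha.eqOn_of_preconnected_of_eventuallyEq hb auxU_preconnected
    (z₀ := 2) (by constructor <;> norm_num) ?_ hs
  have : {z : ℂ | 1 < z.re} ∈ 𝓝 (2 : ℂ) :=
    (isOpen_lt continuous_const Complex.continuous_re).mem_nhds (by simp)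
  filter_upwards [this] with z hz
  exact auxT_tsum1 hz

noncomputable def auxd (k : ℕ) : ℝ := (-1) ^ k * (k * Real.log k)

theorem auxE_deriv_neg_one {k : ℕ} (hk : k ≠ 0) : HasDerivAt (auxE k) ((-auxd k : ℝ) : ℂ) (-1) := by
  refine (auxE_diff hk (-1)).congr_deriv ?_
  unfold auxd
  rw [neg_neg, cpow_one]
  push_cast
  ring

theorem aux_neg_one_mem : (-1 : ℂ) ∈ auxU := by constructor <;> norm_num

theorem auxd_hasSum : HasSum (fun k => auxd (k+1) + 3 * auxd (k+2) + 3 * auxd (k+3) + auxd (k+4))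
    (-8 * (1/3 * Real.log 2 + 3 * zetaD1) - 7 * auxd 1 - 4 * auxd 2 - auxd 3) := by
  have h := hasSum_deriv_of_summable_norm auxT_summable
      (fun i z _ => (auxT_diff i z).differentiableAt.differentiableWithinAt) auxU_open
      (fun i w hw => auxT_bound i hw) aux_neg_one_mem
  have heq : (fun w => ∑' k, auxT k w) =ᶠ[𝓝 (-1)]
      (fun s => -8 * auxCZ s + 7 * auxE 1 s + 4 * auxE 2 s + auxE 3 s) := by
    filter_upwards [auxU_open.mem_nhds aux_neg_one_mem] with z hz
    exact auxT_tsum hz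
  rw [heq.deriv_eq] at h
  have d0 := (auxCZ_diff (-1)).hasDerivAt
  rw [auxCZ_deriv] at d0
  have d1 := auxE_deriv_neg_one one_ne_zero
  have d2 := auxE_deriv_neg_one two_ne_zero
  have d3 := auxE_deriv_neg_one three_ne_zero
  have d := (((d0.const_mul (-8)).add (d1.const_mul 7)).add (d2.const_mul 4)).add d3
  have d' : deriv (fun s => -8 * auxCZ s + 7 * auxE 1 s + 4 * auxE 2 s + auxE 3 s) (-1) = _ :=
    d.deriv
  rw [d'] at h
  have h2 := Complex.hasSum_re h
  convert! h2 using 1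
  · ext k
    have t : deriv (auxT k) (-1) = _ :=
      (((((auxE_deriv_neg_one (k := k+1) (by simp)).add
      ((auxE_deriv_neg_one (k := k+2) (by simp)).const_mul 3)).add
      ((auxE_deriv_neg_one (k := k+3) (by simp)).const_mul 3)).add
        (auxE_deriv_neg_one (k := k+4) (by simp))).neg).deriv
    rw [t]
    have : (-(((-auxd (k+1) : ℝ) : ℂ) + 3 * ((-auxd (k+2) : ℝ) : ℂ) + 3 * ((-auxd (k+3) : ℝ) : ℂ)
      + ((-auxd (k+4) : ℝ) : ℂ))) =
      ((auxd (k+1) + 3 * auxd (k+2) + 3 * auxd (k+3) + auxd (k+4) : ℝ) : ℂ) := by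
      push_cast; ring
    rw [this, Complex.ofReal_re]
  · have hl : (Complex.log 2) = ((Real.log 2 : ℝ) : ℂ) := by
      rw [Complex.ofReal_log (by norm_num)]; norm_num
    have hlr : (Complex.log 2).re = Real.log 2 := by rw [hl, Complex.ofReal_re]
    simp [zetaD1]
    rw [hlr]
    ring

theorem auxd_partial (N : ℕ) : ∑ k ∈ Finset.range N,
    (auxd (k+1) + 3 * auxd (k+2) + 3 * auxd (k+3) + auxd (k+4))
    = 8 * ∑ k ∈ Finset.range N, auxd (k+1) + 7 * auxd (N+1) + 4 * auxd (N+2) + auxd (N+3)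
      - 7 * auxd 1 - 4 * auxd 2 - auxd 3 := by
  induction N with
  | zero => simp; ring
  | succ n ih =>
    rw [Finset.sum_range_succ, ih, Finset.sum_range_succ]
    ring_nf

theorem auxd_tendsto : Tendsto (fun N : ℕ => ∑ k ∈ Finset.range N, auxd (k+1)
    + 7/8 * auxd (N+1) + 1/2 * auxd (N+2) + 1/8 * auxd (N+3)) atTop
    (𝓝 (-(1/3 * Real.log 2 + 3 * zetaD1))) := by
  have h := auxd_hasSum.tendsto_sum_nat
  have h2 := (h.add_const (7 * auxd 1 + 4 * auxd 2 + auxd 3)).const_mul (1/8 : ℝ)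
  convert! h2 using 1
  · ext N
    rw [auxd_partial]
    ring
  · congr 1
    ring
end partB
section partC
open Real Set Filter Topology MeasureTheory

theorem aux_seq_bounds {x : ℝ} (h0 : 0 < x) (h1 : x ≤ 1) {n : ℕ} (hn : n ≠ 0) :
    BohrMollerup.logGammaSeq x n ≤ Real.log (Real.Gamma x) ∧
    Real.log (Real.Gamma x) ≤ (Real.log (n + 1) - Real.log n) + BohrMollerup.logGammaSeq x n := by
  have hf : ∀ {y : ℝ}, 0 < y → (Real.log ∘ Real.Gamma) (y + 1)
      = (Real.log ∘ Real.Gamma) y + Real.log y := by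
    intro y hy
    simp only [Function.comp]
    rw [aux_LG_succ hy]; ring
  have a := BohrMollerup.ge_logGammaSeq convexOn_log_Gamma hf h0 hn
  have b := BohrMollerup.le_logGammaSeq convexOn_log_Gamma hf h0 h1 n
  simp only [Function.comp, Gamma_one, Real.log_one, zero_add] at a b
  refine ⟨a, b.trans ?_⟩
  have hpos : (0:ℝ) < n := by exact_mod_cast Nat.pos_of_ne_zero hn
  have : 0 ≤ Real.log (n + 1) - Real.log n :=
    sub_nonneg.2 (Real.log_le_log hpos (by linarith))
  nlinarith

theorem aux_sum_id (p : ℕ) : ∑ m ∈ Finset.range p,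
    (((m:ℝ) + 1) * Real.log (m + 1) - ((m:ℝ) + 1/2) * Real.log (m + 1/2) - 1/2)
    = 1/2 * ∑ k ∈ Finset.range (2 * p), auxd (k + 1) - 1/2 * p * Real.log 2 - p / 2 := by
  induction p with
  | zero => simp
  | succ p ih =>
    rw [Finset.sum_range_succ, ih, show 2 * (p + 1) = 2 * p + 1 + 1 by ring,
      Finset.sum_range_succ, Finset.sum_range_succ]
    have hp : (0:ℝ) ≤ p := Nat.cast_nonneg p
    have a1 : auxd (2 * p + 1) = -((2 * p + 1) * (Real.log 2 + Real.log (p + 1/2))) := by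
      rw [← Real.log_mul two_ne_zero (by positivity)]
      unfold auxd
      rw [pow_succ, pow_mul]
      push_cast
      rw [show (2:ℝ) * (p + 1/2) = 2 * p + 1 by ring]
      simp
    have a2 : auxd (2 * p + 1 + 1) = ((2 * p + 2) * (Real.log 2 + Real.log (p + 1))) := by
      rw [← Real.log_mul two_ne_zero (by positivity)]
      unfold auxd
      rw [show 2 * p + 1 + 1 = 2 * (p + 1) by ring, pow_mul]
      push_cast
      rw [show (2:ℝ) * p + 2 = 2 * (p + 1) by ring]
      simp
    rw [a1, a2]
    push_cast
    ring

theorem aux_seq_cont (n : ℕ) :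
    ContinuousOn (fun x => BohrMollerup.logGammaSeq x n) (Icc (1/2) 1) := by
  unfold BohrMollerup.logGammaSeq
  apply ContinuousOn.sub (by fun_prop)
  apply continuousOn_finsetSum
  intro m _
  apply ContinuousOn.log (by fun_prop)
  intro x hx
  have : (0:ℝ) ≤ m := Nat.cast_nonneg m
  have := hx.1
  linarith

theorem aux_seq_int (n : ℕ) : ∫ x in (1/2:ℝ)..1, BohrMollerup.logGammaSeq x n =
    3/8 * Real.log n + 1/2 * Real.log (n.factorial) -
    ∑ m ∈ Finset.range (n + 1),
    (((m:ℝ) + 1) * Real.log (m + 1) - ((m:ℝ) + 1/2) * Real.log (m + 1/2) - 1/2) := by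
  have hi : ∀ m : ℕ, IntervalIntegrable (fun x : ℝ => Real.log (x + m)) volume (1/2) 1 := by
    intro m
    apply ContinuousOn.intervalIntegrable
    apply ContinuousOn.log (by fun_prop)
    intro x hx
    rw [uIcc_of_le (by norm_num)] at hx
    have : (0:ℝ) ≤ m := Nat.cast_nonneg m
    have := hx.1
    linarith
  unfold BohrMollerup.logGammaSeq
  rw [intervalIntegral.integral_sub (by apply Continuous.intervalIntegrable; fun_prop)
    (by
      have := IntervalIntegrable.sum (Finset.range (n+1)) (fun m _ => hi m)
      refine this.congr ?_
      intro x _; simp),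
    intervalIntegral.integral_finsetSum (fun m _ => hi m),
    intervalIntegral.integral_add (by apply Continuous.intervalIntegrable; fun_prop) (by simp),
    intervalIntegral.integral_mul_const]
  congr 1
  · simp
    ring
  · apply Finset.sum_congr rfl
    intro m _
    rw [intervalIntegral.integral_comp_add_right (fun x => Real.log x), integral_log,
      add_comm 1 (m:ℝ), add_comm (1/2) (m:ℝ)]
    ring

theorem aux_seq_tendsto : Tendsto (fun n : ℕ => ∫ x in (1/2:ℝ)..1, BohrMollerup.logGammaSeq x n)
    atTop (𝓝 (-auxM (1/2))) := by
  have hI : ∫ x in (1/2:ℝ)..1, Real.log (Real.Gamma x) = -auxM (1/2) := by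
    rw [← auxM_sub (by norm_num) (by norm_num)]
    simp [auxM]
  rw [← hI]
  have hL := aux_int_LG (a := 1/2) (b := 1) (by norm_num) (by norm_num)
  have hS : ∀ n : ℕ, IntervalIntegrable (fun x => BohrMollerup.logGammaSeq x n) volume (1/2) 1 :=
    fun n => ContinuousOn.intervalIntegrable (by
      rw [uIcc_of_le (by norm_num)]; exact aux_seq_cont n)
  have ht := Real.tendsto_log_nat_add_one_sub_log
  refine tendsto_of_tendsto_of_tendsto_of_le_of_le'
    (g := fun n : ℕ => (∫ x in (1/2:ℝ)..1, Real.log (Real.Gamma x))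
      - 1/2 * (Real.log (n + 1) - Real.log n)) ?_ tendsto_const_nhds ?_ ?_
  · have h := (tendsto_const_nhds (x := ∫ x in (1/2:ℝ)..1, Real.log (Real.Gamma x))).sub
      (ht.const_mul (1/2))
    rw [mul_zero, sub_zero] at h
    exact h
  · filter_upwards [eventually_ne_atTop 0] with n hn
    have h := intervalIntegral.integral_mono_on (by norm_num : (1/2:ℝ) ≤ 1) hL
      ((intervalIntegrable_const (c := Real.log (n + 1) - Real.log n)).add (hS n))
      (fun x hx => (aux_seq_bounds (by linarith [hx.1]) hx.2 hn).2)
    rw [intervalIntegral.integral_add intervalIntegrable_const (hS n)] at h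
    simp only [intervalIntegral.integral_const, smul_eq_mul] at h
    linarith
  · filter_upwards [eventually_ne_atTop 0] with n hn
    exact intervalIntegral.integral_mono_on (by norm_num : (1/2:ℝ) ≤ 1) (hS n) hL
      (fun x hx => (aux_seq_bounds (by linarith [hx.1]) hx.2 hn).1)

theorem aux_stirling : Tendsto (fun n : ℕ => Real.log (n.factorial)
    - (1/2 * Real.log (2 * n) + n * Real.log n - n)) atTop (𝓝 (1/2 * Real.log π)) := by
  have h := Stirling.tendsto_stirlingSeq_sqrt_pi.log (Real.sqrt_pos.2 Real.pi_pos).ne'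
  rw [Real.log_sqrt Real.pi_pos.le] at h
  rw [show 1/2 * Real.log π = Real.log π / 2 by ring]
  refine h.congr' ?_
  filter_upwards [eventually_ne_atTop 0] with n hn
  have hpos : (0:ℝ) < n := by exact_mod_cast Nat.pos_of_ne_zero hn
  have hf : (0:ℝ) < n.factorial := by exact_mod_cast n.factorial_pos
  unfold Stirling.stirlingSeq
  rw [Real.log_div hf.ne' (by positivity), Real.log_mul (by positivity) (by positivity),
    Real.log_sqrt (by positivity), Real.log_pow, Real.log_div hpos.ne' (by positivity),
    Real.log_exp]
  ring

theorem aux_xlog (b : ℝ) (hb : 0 < b) : Tendsto (fun n : ℕ => (2 * (n:ℝ) + b) * Real.log (2 * n + b)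
    - (2 * n + b) * Real.log (2 * n)) atTop (𝓝 b) := by
  have hx : Tendsto (fun n : ℕ => 2 * (n:ℝ)) atTop atTop :=
    tendsto_natCast_atTop_atTop.const_mul_atTop two_pos
  have h1 := (Real.tendsto_mul_log_one_add_div_atTop b).comp hx
  have h2 : Tendsto (fun n : ℕ => b * Real.log (1 + b / (2 * n))) atTop (𝓝 0) := by
    have := (((tendsto_const_nhds (x := b)).div_atTop hx).const_add 1).log (by norm_num)
    simpa using this.const_mul b
  have h3 := h1.add h2
  rw [add_zero] at h3
  refine h3.congr' ?_
  filter_upwards [eventually_ne_atTop 0] with n hn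
  have hpos : (0:ℝ) < n := by exact_mod_cast Nat.pos_of_ne_zero hn
  have : 2 * (n:ℝ) + b = 2 * n * (1 + b / (2 * n)) := by field_simp
  have hl : Real.log (2 * n + b) = Real.log (2 * n) + Real.log (1 + b / (2 * n)) := by
    rw [this, Real.log_mul (by positivity) (by positivity)]
  rw [hl]
  simp only [Function.comp]
  ring

theorem aux_key : auxM (1/2) = 1/8 - 1/4 * Real.log 2 - 1/4 * Real.log Real.pi - 3/2 * zetaD1
    - 1/24 * Real.log 2 := by
  have hN : Tendsto (fun n : ℕ => 2 * (n + 1)) atTop atTop :=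
    tendsto_atTop_mono (fun n => (by omega : n ≤ 2 * (n + 1))) tendsto_id
  have hd := auxd_tendsto.comp hN
  have hA := ((aux_stirling.const_mul (1/2)).sub (hd.const_mul (1/2))).sub
    ((((aux_xlog 3 (by norm_num)).const_mul (7/16)).sub
      ((aux_xlog 4 (by norm_num)).const_mul (1/4))).add
      ((aux_xlog 5 (by norm_num)).const_mul (1/16)))
  have hB := hA.add_const (7/24 * Real.log 2 - 1/6 * Real.log 2 + 1/2)
  have hE : -auxM (1/2) = (1 / 2 * (1 / 2 * Real.log π) - 1 / 2 * -(1 / 3 * Real.log 2 + 3 * zetaD1)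
      - (7 / 16 * 3 - 1 / 4 * 4 + 1 / 16 * 5) +
        (7 / 24 * Real.log 2 - 1 / 6 * Real.log 2 + 1 / 2)) := by
    refine tendsto_nhds_unique aux_seq_tendsto (hB.congr' ?_)
    filter_upwards [eventually_ne_atTop 0] with n hn
    have hpos : (0:ℝ) < n := by exact_mod_cast Nat.pos_of_ne_zero hn
    rw [aux_seq_int, aux_sum_id]
    simp only [Function.comp]
    have a1 : auxd (2 * (n + 1) + 1) = -((2 * n + 3) * Real.log (2 * n + 3)) := by
      unfold auxd
      rw [pow_succ, pow_mul]
      push_cast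
      rw [show (2:ℝ) * (n + 1) + 1 = 2 * n + 3 by ring]
      simp
    have a2 : auxd (2 * (n + 1) + 2) = ((2 * n + 4) * Real.log (2 * n + 4)) := by
      unfold auxd
      rw [pow_add, pow_mul]
      push_cast
      rw [show (2:ℝ) * (n + 1) + 2 = 2 * n + 4 by ring]
      simp
    have a3 : auxd (2 * (n + 1) + 3) = -((2 * n + 5) * Real.log (2 * n + 5)) := by
      unfold auxd
      rw [pow_add, pow_mul]
      push_cast
      rw [show (2:ℝ) * (n + 1) + 3 = 2 * n + 5 by ring]
      norm_num
    rw [a1, a2, a3, Real.log_mul two_ne_zero hpos.ne']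
    push_cast
    ring
  linarith
end partC
theorem stmt6 (lam ν : ℝ) (hlam : lam ∈ Set.Ioo (0:ℝ) (1 / Real.pi))
    (hν : -(1/2 : ℝ) < ν) (hσν : sig lam < 1 + 2 * ν) :
    -(3 * (sig lam) ^ 2 / 2) * Real.log 2
      + (Jp ν lam - Jm ν lam) - 2 * (Jp 0 lam - Jm 0 lam)
      = CS ν (sfun lam) := by
  obtain ⟨h0, h1⟩ := hlam
  have hs1 := aux_sig_lt_one h1
  have hs0 := aux_sig_pos h0
  have hr : ∀ l ∈ Set.Icc 0 lam, 0 ≤ sig l ∧ sig l ≤ sig lam := fun l hl =>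
    ⟨by simpa [aux_sig_zero] using aux_sig_mono hl.1, aux_sig_mono hl.2⟩
  have hp : ∀ μ : ℝ, -(1/2) < μ → Jp μ lam = _ := fun μ hμ => by
    have := aux_J (lam := lam) (ν := μ) (e := 1) one_ne_zero h0 h1 (fun l hl => by
      linarith [hr l hl])
    simp only [one_mul] at this
    exact this
  have hm : ∀ μ : ℝ, sig lam < 1 + 2 * μ → Jm μ lam = _ := fun μ hμ => by
    have := aux_J (lam := lam) (ν := μ) (e := -1) (by norm_num) h0 h1 (fun l hl => by
      linarith [hr l hl])
    simp only [neg_one_mul, ← sub_eq_add_neg] at this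
    exact this
  rw [hp ν hν, hp 0 (by norm_num), hm ν hσν, hm 0 (by linarith)]
  have hsd : sfun lam = (1 - sig lam) / 2 := rfl
  obtain ⟨s, hs⟩ : ∃ s, s = sfun lam := ⟨_, rfl⟩
  have hsig : sig lam = 1 - 2 * s := by rw [hs, hsd]; ring
  rw [← hs]
  rw [hsig] at hs0 hs1 hσν ⊢
  have hspos : 0 < s := by linarith
  have hshalf : s < 1/2 := by linarith
  have e1 : (1 + (1 - 2 * s)) / 2 = 1 - s := by ring
  have e2 : (1 - (1 - 2 * s)) / 2 = s := by ring
  rw [e1, e2]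
  unfold CS
  have g0 : Real.log (Real.Gamma (1/2)) = 1/2 * Real.log Real.pi := by
    rw [Real.Gamma_one_half_eq, Real.log_sqrt Real.pi_pos.le]; ring
  have gp : ∀ x : ℝ, 0 < x → Real.Gamma x ≠ 0 := fun x hx => (Real.Gamma_pos_of_pos hx).ne'
  have q1 := gp s hspos
  have q2 := gp (1 - s) (by linarith)
  have q3 := gp (1 - s + ν) (by linarith)
  have q4 := gp (1 + s + ν) (by linarith)
  have q5 := gp (1/2 + ν) (by linarith)
  rw [Real.log_div (by positivity) (by positivity), Real.log_mul (by positivity) q3,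
    Real.log_mul (by positivity) q4, Real.log_div (by positivity) (by positivity),
    Real.log_mul q3 q4, Real.log_pow, Real.log_pow, Real.log_pow]
  simp only [aux_FG]
  have r1 := aux_raabe hspos
  have r2 := aux_raabe (y := s + ν) (by linarith)
  have l1 := aux_LG_succ hspos
  have l2 := aux_LG_succ (y := s + ν) (by linarith)
  have c1 : 1 + (ν - s) = 1 - s + ν := by ring
  have c2 : 1 + (ν + s) = s + ν + 1 := by ring
  have c3 : 1 + -s = 1 - s := by ring
  have c4 : 1 + s = s + 1 := by ring
  have c5 : 1 + s + ν = s + ν + 1 := by ring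
  have c6 : 1 + -(1/2) = (1/2 : ℝ) := by norm_num
  have c7 : 1 + (ν - 1/2) = 1/2 + ν := by ring
  have c8 : ν + (1 - s) = 1 - s + ν := by ring
  rw [c1, c2, c3, c5, c4, c6, c7, c8, add_comm ν (1/2), add_comm ν s, r1, r2, l1, l2, g0, aux_key]
  have hl : Real.log (2 * Real.pi) = Real.log 2 + Real.log Real.pi :=
    Real.log_mul two_ne_zero Real.pi_ne_zero
  rw [hl]
  simp only [zero_add]
  rw [aux_key]
  push_cast
  ring
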